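/- arXiv:2601.09175 — 2 statements merged into one kernel-verified Lean document; each statement's English description precedes it below -/
import Mathlib

section
/- Let n ≥ 1 and 1 ≤ q ≤ p < ∞. Then tilde-M^p_q(ℝ^n) = bar-M^p_q(ℝ^n) ∩ star-M^p_q(ℝ^n); that is, a function f ∈ M^p_q(ℝ^n) lies in the M^p_q-closure of C_c^∞(ℝ^n) if and only if it lies both in the M^p_q-closure of L^∞(ℝ^n) ∩ M^p_q(ℝ^n) and in the M^p_q-closure of the compactly supported measurable functions in M^p_q(ℝ^n). -/
open MeasureTheory Metric ENNReal

noncomputable section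

/-- Euclidean space ℝⁿ. -/
abbrev Eucl (n : ℕ) := EuclideanSpace ℝ (Fin n)

/-- The Morrey norm ‖f‖_{M^p_q}. -/
noncomputable def morreyNorm (n : ℕ) (p q : ℝ) (f : Eucl n → ℝ) : ℝ≥0∞ :=
  ⨆ (x : Eucl n) (r : ℝ) (_ : 0 < r),
    (volume (ball x r)) ^ (1 / p - 1 / q) *
      (∫⁻ y in ball x r, ENNReal.ofReal (|f y| ^ q)) ^ (1 / q)

/-- Membership in the Morrey space M^p_q(ℝⁿ). -/
def MemMorrey (n : ℕ) (p q : ℝ) (f : Eucl n → ℝ) : Prop :=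
  Measurable f ∧ morreyNorm n p q f < ⊤

/-- Average of `b` over the ball `B(x,r)`. -/
noncomputable def ballAvg (n : ℕ) (b : Eucl n → ℝ) (x : Eucl n) (r : ℝ) : ℝ :=
  ⨍ y in ball x r, b y

/-- The BMO norm ‖b‖_*. -/
noncomputable def bmoNorm (n : ℕ) (b : Eucl n → ℝ) : ℝ≥0∞ :=
  ⨆ (x : Eucl n) (r : ℝ) (_ : 0 < r),
    (volume (ball x r))⁻¹ *
      ∫⁻ y in ball x r, ENNReal.ofReal |b y - ballAvg n b x r|

/-- Membership in BMO(ℝⁿ). -/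
def MemBMO (n : ℕ) (b : Eucl n → ℝ) : Prop :=
  LocallyIntegrable b volume ∧ bmoNorm n b < ⊤

/-- Smooth compactly supported functions (the class C_c^∞). -/
def IsCcSmooth (n : ℕ) (φ : Eucl n → ℝ) : Prop :=
  ContDiff ℝ (⊤ : ℕ∞) φ ∧ HasCompactSupport φ

/-- VMO(ℝⁿ): the closure of C_c^∞ in the BMO norm. -/
def MemVMO (n : ℕ) (b : Eucl n → ℝ) : Prop :=
  MemBMO n b ∧ ∀ ε : ℝ, 0 < ε → ∃ φ : Eucl n → ℝ, IsCcSmooth n φ ∧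
    bmoNorm n (fun x => b x - φ x) < ENNReal.ofReal ε

/-- The tilde subspace: closure of C_c^∞ in the Morrey norm. -/
def MemTildeMorrey (n : ℕ) (p q : ℝ) (f : Eucl n → ℝ) : Prop :=
  MemMorrey n p q f ∧ ∀ ε : ℝ, 0 < ε → ∃ φ : Eucl n → ℝ, IsCcSmooth n φ ∧
    morreyNorm n p q (fun x => f x - φ x) < ENNReal.ofReal ε

/-- The bar subspace: closure of L^∞ ∩ M^p_q in the Morrey norm. -/
def MemBarMorrey (n : ℕ) (p q : ℝ) (f : Eucl n → ℝ) : Prop :=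
  MemMorrey n p q f ∧ ∀ ε : ℝ, 0 < ε → ∃ g : Eucl n → ℝ, MemMorrey n p q g ∧
    (∃ C : ℝ, ∀ᵐ x ∂(volume : Measure (Eucl n)), |g x| ≤ C) ∧
    morreyNorm n p q (fun x => f x - g x) < ENNReal.ofReal ε

/-- The star subspace: closure of the compactly supported members of M^p_q. -/
def MemStarMorrey (n : ℕ) (p q : ℝ) (f : Eucl n → ℝ) : Prop :=
  MemMorrey n p q f ∧ ∀ ε : ℝ, 0 < ε → ∃ g : Eucl n → ℝ, MemMorrey n p q g ∧
    HasCompactSupport g ∧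
    morreyNorm n p q (fun x => f x - g x) < ENNReal.ofReal ε

/-- The fractional integral operator I_α. -/
noncomputable def fracInt (n : ℕ) (α : ℝ) (f : Eucl n → ℝ) (x : Eucl n) : ℝ :=
  ∫ y, f y * dist x y ^ (α - (n : ℝ))

/-- The multilinear commutator [a_{{1,…,l}}, I_α]. -/
noncomputable def mlCommutator (n l : ℕ) (α : ℝ) (a : Fin l → Eucl n → ℝ)
    (f : Eucl n → ℝ) (x : Eucl n) : ℝ :=
  ∫ y, (∏ j, (a j x - a j y)) * f y * dist x y ^ (α - (n : ℝ))

end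

/-- The local integral in the Morrey norm is an `L^q` seminorm. -/
theorem lintegral_ofReal_abs_rpow_eq_eLpNorm {α : Type*} [MeasurableSpace α] (μ : Measure α)
    {q : ℝ} (hq : 0 < q) (f : α → ℝ) :
    (∫⁻ y, ENNReal.ofReal (|f y| ^ q) ∂μ) ^ (1 / q) = eLpNorm f (ENNReal.ofReal q) μ := by
  rw [eLpNorm_eq_lintegral_rpow_enorm_toReal (by simpa using hq) ENNReal.ofReal_ne_top,
    ENNReal.toReal_ofReal hq.le]
  simp_rw [← Real.norm_eq_abs, ← ENNReal.ofReal_rpow_of_nonneg (norm_nonneg _) hq.le,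
    ofReal_norm]

theorem morreyNorm_eq_iSup_eLpNorm (n : ℕ) (p : ℝ) {q : ℝ} (hq : 0 < q) (f : Eucl n → ℝ) :
    morreyNorm n p q f = ⨆ (x : Eucl n) (r : ℝ) (_ : 0 < r),
      (volume (ball x r)) ^ (1 / p - 1 / q) *
        eLpNorm f (ENNReal.ofReal q) (volume.restrict (ball x r)) := by
  simp_rw [morreyNorm, lintegral_ofReal_abs_rpow_eq_eLpNorm _ hq]

theorem morreyNorm_mono (n : ℕ) (p : ℝ) {q : ℝ} (hq : 0 < q) {f g : Eucl n → ℝ}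
    (h : ∀ x, |f x| ≤ |g x|) : morreyNorm n p q f ≤ morreyNorm n p q g := by
  simp_rw [morreyNorm_eq_iSup_eLpNorm n p hq]
  gcongr
  exact eLpNorm_mono h

theorem morreyNorm_add_le (n : ℕ) (p : ℝ) {q : ℝ} (hq : 1 ≤ q) {f g : Eucl n → ℝ}
    (hf : Measurable f) (hg : Measurable g) :
    morreyNorm n p q (fun x => f x + g x) ≤ morreyNorm n p q f + morreyNorm n p q g := by
  have hq0 : 0 < q := by linarith
  rw [morreyNorm_eq_iSup_eLpNorm n p hq0 (fun x => f x + g x)]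
  refine iSup_le fun x => iSup_le fun r => iSup_le fun hr => ?_
  calc _ ≤ volume (ball x r) ^ (1 / p - 1 / q) *
        (eLpNorm f (ENNReal.ofReal q) (volume.restrict (ball x r)) +
          eLpNorm g (ENNReal.ofReal q) (volume.restrict (ball x r))) := by
        gcongr
        exact eLpNorm_add_le hf.aestronglyMeasurable hg.aestronglyMeasurable (by simpa using hq)
    _ ≤ _ := by
        rw [mul_add, morreyNorm_eq_iSup_eLpNorm n p hq0 f, morreyNorm_eq_iSup_eLpNorm n p hq0 g]
        gcongr
        · exact le_iSup_of_le x (le_iSup_of_le r (le_iSup_of_le hr le_rfl))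
        · exact le_iSup_of_le x (le_iSup_of_le r (le_iSup_of_le hr le_rfl))

/-- `L^p` embeds contractively into `M^p_q`, by Hölder's inequality. -/
theorem morreyNorm_le_eLpNorm (n : ℕ) {p q : ℝ} (hq : 0 < q) (hqp : q ≤ p) {f : Eucl n → ℝ}
    (hf : AEStronglyMeasurable f volume) :
    morreyNorm n p q f ≤ eLpNorm f (ENNReal.ofReal p) volume := by
  rw [morreyNorm_eq_iSup_eLpNorm n p hq]
  refine iSup_le fun x => iSup_le fun r => iSup_le fun hr => ?_
  have hpos : volume (ball x r) ≠ 0 := (measure_ball_pos volume x hr).ne'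
  have hfin : volume (ball x r) ≠ ⊤ := measure_ball_lt_top.ne
  have key := eLpNorm_le_eLpNorm_mul_rpow_measure_univ (ENNReal.ofReal_le_ofReal hqp)
    (hf.restrict (s := ball x r))
  rw [Measure.restrict_apply_univ, ENNReal.toReal_ofReal hq.le,
    ENNReal.toReal_ofReal (hq.le.trans hqp)] at key
  calc _ ≤ volume (ball x r) ^ (1 / p - 1 / q) *
        (eLpNorm f (ENNReal.ofReal p) (volume.restrict (ball x r)) *
          volume (ball x r) ^ (1 / q - 1 / p)) := by gcongr
    _ = eLpNorm f (ENNReal.ofReal p) (volume.restrict (ball x r)) := by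
        rw [mul_left_comm, ← ENNReal.rpow_add _ _ hpos hfin]
        simp
    _ ≤ _ := eLpNorm_restrict_le _ _ _ _

/-- Bounded functions cut off to a compact set are Morrey limits of test functions. -/
theorem exists_isCcSmooth_morreyNorm_indicator_sub_le (n : ℕ) {p q : ℝ} (hq : 1 ≤ q)
    (hqp : q ≤ p) {K : Set (Eucl n)} (hK : IsCompact K) {g : Eucl n → ℝ} (hg : Measurable g)
    {C : ℝ} (hC : ∀ᵐ x ∂(volume : Measure (Eucl n)), |g x| ≤ C) {ε : ℝ} (hε : 0 < ε) :
    ∃ φ : Eucl n → ℝ, IsCcSmooth n φ ∧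
      morreyNorm n p q (fun x => K.indicator g x - φ x) ≤ ENNReal.ofReal ε := by
  have : IsFiniteMeasure (volume.restrict K) := ⟨by simpa using hK.measure_lt_top⟩
  have hmem : MemLp (K.indicator g) (ENNReal.ofReal p) volume :=
    (memLp_indicator_iff_restrict hK.measurableSet).2
      (MemLp.of_bound hg.aestronglyMeasurable C (ae_restrict_of_ae hC))
  obtain ⟨φ, hφs, hφ, hle⟩ := MemLp.exist_eLpNorm_sub_le ENNReal.ofReal_ne_top
    (by simpa using hq.trans hqp) hmem hε
  refine ⟨φ, ⟨hφ, hφs⟩, (morreyNorm_le_eLpNorm n (by linarith) hqp ?_).trans hle⟩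
  exact hmem.aestronglyMeasurable.sub hφ.continuous.aestronglyMeasurable

theorem IsCcSmooth.exists_abs_le {n : ℕ} {φ : Eucl n → ℝ} (hφ : IsCcSmooth n φ) :
    ∃ C : ℝ, ∀ x, |φ x| ≤ C :=
  hφ.2.exists_bound_of_continuous hφ.1.continuous

/-- A test function at finite Morrey distance from a Morrey function is a Morrey function. -/
theorem IsCcSmooth.memMorrey_of_sub {n : ℕ} {p q : ℝ} (hq : 1 ≤ q) {f φ : Eucl n → ℝ}
    (hf : MemMorrey n p q f) (hφ : IsCcSmooth n φ)
    (h : morreyNorm n p q (fun x => f x - φ x) < ⊤) : MemMorrey n p q φ := by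
  have hφm : Measurable φ := hφ.1.continuous.measurable
  refine ⟨hφm, ?_⟩
  have hsub : morreyNorm n p q (fun x => φ x - f x) < ⊤ :=
    (morreyNorm_mono n p (by linarith) fun x => (abs_sub_comm _ _).le).trans_lt h
  have hadd := morreyNorm_add_le n p hq hf.1 (hφm.sub hf.1)
  simp only [Pi.sub_apply, add_sub_cancel] at hadd
  exact hadd.trans_lt (ENNReal.add_lt_top.2 ⟨hf.2, hsub⟩)

/-- decomposition `tilde-M^p_q = bar-M^p_q ∩ star-M^p_q`. -/
theorem memTildeMorrey_iff_memBarMorrey_and_memStarMorrey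
    (n : ℕ) (hn : 1 ≤ n) (p q : ℝ) (hq : 1 ≤ q) (hqp : q ≤ p)
    (f : Eucl n → ℝ) (hf : MemMorrey n p q f) :
    MemTildeMorrey n p q f ↔ MemBarMorrey n p q f ∧ MemStarMorrey n p q f := by
  have hq0 : 0 < q := by linarith
  constructor
  · rintro ⟨-, happ⟩
    refine ⟨⟨hf, fun ε hε => ?_⟩, ⟨hf, fun ε hε => ?_⟩⟩ <;> obtain ⟨φ, hφ, hlt⟩ := happ ε hε
    · obtain ⟨C, hC⟩ := hφ.exists_abs_le
      exact ⟨φ, hφ.memMorrey_of_sub hq hf hlt.lt_top, ⟨C, .of_forall hC⟩, hlt⟩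
    · exact ⟨φ, hφ.memMorrey_of_sub hq hf hlt.lt_top, hφ.2, hlt⟩
  · rintro ⟨⟨-, hbar⟩, ⟨-, hstar⟩⟩
    refine ⟨hf, fun ε hε => ?_⟩
    have hε3 : 0 < ε / 3 := by positivity
    obtain ⟨g, hg, ⟨C, hC⟩, hfg⟩ := hbar (ε / 3) hε3
    obtain ⟨h, hh, hhs, hfh⟩ := hstar (ε / 3) hε3
    set K := tsupport h
    have hKm : MeasurableSet K := (isClosed_tsupport h).measurableSet
    obtain ⟨φ, hφ, hgφ⟩ := exists_isCcSmooth_morreyNorm_indicator_sub_le n hq hqp hhs hg.1 hC hε3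
    refine ⟨φ, hφ, ?_⟩
    have hin : Measurable (K.indicator fun x => f x - g x) := (hf.1.sub hg.1).indicator hKm
    have hout : Measurable (Kᶜ.indicator fun x => f x - h x) :=
      (hf.1.sub hh.1).indicator hKm.compl
    have hrest : Measurable fun x => K.indicator g x - φ x :=
      (hg.1.indicator hKm).sub hφ.1.continuous.measurable
    have hdecomp : (fun x => f x - φ x) = fun x =>
        (K.indicator (fun x => f x - g x) x + Kᶜ.indicator (fun x => f x - h x) x) +
          (K.indicator g x - φ x) := by
      funext x
      by_cases hx : x ∈ K
      · simp [hx]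
      · simp [hx, image_eq_zero_of_notMem_tsupport hx, sub_eq_add_neg]
    rw [hdecomp]
    calc _ ≤ morreyNorm n p q (K.indicator fun x => f x - g x) +
          morreyNorm n p q (Kᶜ.indicator fun x => f x - h x) +
          morreyNorm n p q (fun x => K.indicator g x - φ x) :=
        (morreyNorm_add_le n p hq (hin.add hout) hrest).trans
          (add_le_add_left (morreyNorm_add_le n p hq hin hout) _)
      _ ≤ morreyNorm n p q (fun x => f x - g x) + morreyNorm n p q (fun x => f x - h x) +
          ENNReal.ofReal (ε / 3) :=
        add_le_add (add_le_add
          (morreyNorm_mono n p hq0 fun x => norm_indicator_le_norm_self (fun x => f x - g x) x)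
          (morreyNorm_mono n p hq0 fun x => norm_indicator_le_norm_self (fun x => f x - h x) x))
          hgφ
      _ < ENNReal.ofReal (ε / 3) + ENNReal.ofReal (ε / 3) + ENNReal.ofReal (ε / 3) :=
        ENNReal.add_lt_add_right ENNReal.ofReal_ne_top (ENNReal.add_lt_add hfg hfh)
      _ = ENNReal.ofReal ε := by
        rw [← ENNReal.ofReal_add hε3.le hε3.le, ← ENNReal.ofReal_add (by positivity) hε3.le]
        congr 1
        ring
end

section
/- (Adams' theorem) Let n ≥ 1, 0 < α < n, 1 < q ≤ p < ∞, and let s, t satisfy 1/s = 1/p − α/n > 0 and p/q = s/t. Then for every f ∈ M^p_q(ℝ^n), the integral defining I_α f(x) = ∫_{ℝ^n} f(y) |x−y|^{α−n} dy converges absolutely for almost every x ∈ ℝ^n, and there is a constant C, independent of f, such that ‖I_α f‖_{M^s_t} ≤ C ‖f‖_{M^p_q}. -/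
open MeasureTheory Metric ENNReal

/-- The centred Hardy–Littlewood maximal function of a nonnegative function. -/
noncomputable def hlMaximal {n : ℕ} (g : Eucl n → ℝ≥0∞) (x : Eucl n) : ℝ≥0∞ :=
  ⨆ (r : ℝ) (_ : 0 < r), (∫⁻ y in ball x r, g y) / volume (ball x r)

theorem volume_ball_eucl {n : ℕ} (x : Eucl n) {r : ℝ} (hr : 0 < r) :
    volume (ball x r) = ENNReal.ofReal (r ^ n) * volume (ball (0 : Eucl n) 1) := by
  rw [Measure.addHaar_ball_of_pos _ _ hr, finrank_euclideanSpace_fin]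

theorem volume_ball_ne_zero {n : ℕ} (x : Eucl n) {r : ℝ} (hr : 0 < r) :
    volume (ball x r) ≠ 0 := (measure_ball_pos volume x hr).ne'

theorem volume_ball_ne_top {n : ℕ} (x : Eucl n) (r : ℝ) :
    volume (ball x r) ≠ ⊤ := measure_ball_lt_top.ne

section Swap

variable {X Y : Type*} [MeasurableSpace X] [MeasurableSpace Y]

theorem lintegral_mul_setLIntegral_swap (μ : Measure X) (ν : Measure Y) [SFinite μ] [SFinite ν]
    {g : X → ℝ≥0∞} {w : Y → ℝ≥0∞} (hg : Measurable g) (hw : Measurable w)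
    {S : Set (X × Y)} (hS : MeasurableSet S) :
    ∫⁻ x, g x * ∫⁻ y in {y | (x, y) ∈ S}, w y ∂ν ∂μ =
      ∫⁻ y, w y * ∫⁻ x in {x | (x, y) ∈ S}, g x ∂μ ∂ν := by
  have h1 (x : X) : g x * ∫⁻ y in {y | (x, y) ∈ S}, w y ∂ν =
      ∫⁻ y, S.indicator (fun z : X × Y => g z.1 * w z.2) (x, y) ∂ν := by
    have hm : MeasurableSet {y | (x, y) ∈ S} := measurable_prodMk_left hS
    rw [← lintegral_indicator hm, ← lintegral_const_mul _ (hw.indicator hm)]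
    refine lintegral_congr fun y => ?_
    by_cases h : (x, y) ∈ S <;> simp [Set.indicator, h]
  have h2 (y : Y) : w y * ∫⁻ x in {x | (x, y) ∈ S}, g x ∂μ =
      ∫⁻ x, S.indicator (fun z : X × Y => g z.1 * w z.2) (x, y) ∂μ := by
    have hm : MeasurableSet {x | (x, y) ∈ S} := measurable_prodMk_right hS
    rw [← lintegral_indicator hm, ← lintegral_const_mul _ (hg.indicator hm)]
    refine lintegral_congr fun x => ?_
    by_cases h : (x, y) ∈ S <;> simp [Set.indicator, h, mul_comm]
  simp_rw [h1, h2]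
  refine lintegral_lintegral_swap (Measurable.aemeasurable ?_)
  exact ((hg.comp measurable_fst).mul (hw.comp measurable_snd)).indicator hS

end Swap

theorem lintegral_Ioc_rpow {a δ : ℝ} (ha : 0 < a) (hδ : 0 ≤ δ) :
    ∫⁻ τ in Set.Ioc 0 δ, ENNReal.ofReal (τ ^ (a - 1)) = ENNReal.ofReal (δ ^ a / a) := by
  rw [← ofReal_integral_eq_lintegral_ofReal, ← intervalIntegral.integral_of_le hδ,
    integral_rpow (Or.inl (by linarith))]
  · simp [Real.zero_rpow ha.ne']
  · exact (intervalIntegrable_iff_integrableOn_Ioc_of_le hδ).1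
      (intervalIntegral.intervalIntegrable_rpow' (by linarith))
  · filter_upwards [ae_restrict_mem measurableSet_Ioc] with τ hτ
    exact Real.rpow_nonneg hτ.1.le _

theorem lintegral_Ioi_rpow {b δ : ℝ} (hb : 0 < b) (hδ : 0 < δ) :
    ∫⁻ τ in Set.Ioi δ, ENNReal.ofReal (τ ^ (-b - 1)) = ENNReal.ofReal (δ ^ (-b) / b) := by
  rw [← ofReal_integral_eq_lintegral_ofReal, integral_Ioi_rpow_of_lt (by linarith) hδ]
  · congr 1
    rw [sub_add_cancel, neg_div_neg_eq]
  · exact integrableOn_Ioi_rpow_of_lt (by linarith) hδ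
  · filter_upwards [ae_restrict_mem measurableSet_Ioi] with τ hτ
    exact Real.rpow_nonneg (hδ.trans hτ).le _

theorem lintegral_ofReal_lt_rpow {q : ℝ} (hq : 0 < q) (a : ℝ≥0∞) :
    ∫⁻ τ in {τ : ℝ | 0 < τ ∧ ENNReal.ofReal τ < a}, ENNReal.ofReal (τ ^ (q - 1)) =
      a ^ q / ENNReal.ofReal q := by
  by_cases ha : a = ⊤
  · subst ha
    rw [ENNReal.top_rpow_of_pos hq, ENNReal.top_div_of_ne_top ofReal_ne_top, eq_top_iff]
    have hlim : Filter.Tendsto (fun N : ℕ => ENNReal.ofReal ((N : ℝ) ^ q / q)) Filter.atTop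
        (nhds ⊤) :=
      ENNReal.tendsto_ofReal_atTop.comp
        (((tendsto_rpow_atTop hq).comp tendsto_natCast_atTop_atTop).atTop_div_const hq)
    refine le_of_tendsto' hlim fun N => ?_
    rw [← lintegral_Ioc_rpow hq N.cast_nonneg]
    exact lintegral_mono_set fun τ hτ => ⟨hτ.1, ofReal_lt_top⟩
  · lift a to NNReal using ha
    have : {τ : ℝ | 0 < τ ∧ ENNReal.ofReal τ < a} = Set.Ioo 0 (a : ℝ) := by
      ext τ
      simp only [Set.mem_ofPred_eq, Set.mem_Ioo, and_congr_right_iff]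
      intro h
      rw [← ENNReal.ofReal_coe_nnreal, ENNReal.ofReal_lt_ofReal_iff_of_nonneg h.le]
    rw [this, setLIntegral_congr Ioo_ae_eq_Ioc, lintegral_Ioc_rpow hq a.coe_nonneg,
      ENNReal.ofReal_div_of_pos hq, ← ENNReal.ofReal_rpow_of_nonneg a.coe_nonneg hq.le,
      ENNReal.ofReal_coe_nnreal]

section Maximal

variable {n : ℕ}

theorem lowerSemicontinuous_setLIntegral_ball (g : Eucl n → ℝ≥0∞) (r : ℝ) :
    LowerSemicontinuous fun x => ∫⁻ y in ball x r, g y := by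
  intro x a ha
  have hU : ball x r = ⋃ m : ℕ, ball x (r - 1 / (m + 1)) := by
    ext y
    simp only [mem_ball, Set.mem_iUnion]
    constructor
    · intro h
      obtain ⟨m, hm⟩ := exists_nat_one_div_lt (sub_pos.2 h)
      exact ⟨m, by linarith⟩
    · rintro ⟨m, hm⟩
      have : (0 : ℝ) < 1 / (m + 1) := by positivity
      linarith
  have hmono : Monotone fun m : ℕ => ball x (r - 1 / ((m : ℝ) + 1)) := fun i j hij =>
    ball_subset_ball (sub_le_sub_left (one_div_le_one_div_of_le (by positivity) (by gcongr)) r)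
  replace ha : a < ∫⁻ y in ball x r, g y := ha
  rw [hU, setLIntegral_iUnion_of_directed g hmono.directed_le, lt_iSup_iff] at ha
  obtain ⟨m, hm⟩ := ha
  filter_upwards [ball_mem_nhds x (show (0 : ℝ) < 1 / (m + 1) by positivity)] with z hz
  refine hm.trans_le (lintegral_mono_set (ball_subset_ball' ?_))
  rw [mem_ball, dist_comm] at hz
  linarith

theorem lowerSemicontinuous_hlMaximal (g : Eucl n → ℝ≥0∞) :
    LowerSemicontinuous (hlMaximal g) := by
  refine lowerSemicontinuous_biSup fun r hr => ?_
  intro x a ha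
  replace ha : a < (∫⁻ y in ball x r, g y) / volume (ball x r) := ha
  rw [volume_ball_eucl x hr, ← volume_ball_eucl (0 : Eucl n) hr,
    ENNReal.lt_div_iff_mul_lt (Or.inl (volume_ball_ne_zero _ hr))
      (Or.inl (volume_ball_ne_top _ _))] at ha
  filter_upwards [lowerSemicontinuous_setLIntegral_ball g r x _ ha] with z hz
  change a < (∫⁻ y in ball z r, g y) / volume (ball z r)
  rwa [volume_ball_eucl z hr, ← volume_ball_eucl (0 : Eucl n) hr,
    ENNReal.lt_div_iff_mul_lt (Or.inl (volume_ball_ne_zero _ hr))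
      (Or.inl (volume_ball_ne_top _ _))]

theorem measurable_hlMaximal (g : Eucl n → ℝ≥0∞) : Measurable (hlMaximal g) :=
  (lowerSemicontinuous_hlMaximal g).measurable

theorem setLIntegral_ball_le_hlMaximal (g : Eucl n → ℝ≥0∞) (x : Eucl n) {r : ℝ} (hr : 0 < r) :
    ∫⁻ y in ball x r, g y ≤ hlMaximal g x * volume (ball x r) := by
  rw [← ENNReal.div_le_iff (volume_ball_ne_zero _ hr) (volume_ball_ne_top _ _)]
  exact le_iSup₂_of_le r hr le_rfl

theorem hlMaximal_le_add {g h : Eucl n → ℝ≥0∞} (hh : Measurable h) {b : ℝ≥0∞}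
    (hb : ∀ y, g y ≤ h y + b) (x : Eucl n) : hlMaximal g x ≤ hlMaximal h x + b := by
  refine iSup₂_le fun r hr => ?_
  rw [ENNReal.div_le_iff (volume_ball_ne_zero _ hr) (volume_ball_ne_top _ _)]
  calc ∫⁻ y in ball x r, g y ≤ ∫⁻ y in ball x r, (h y + b) := lintegral_mono hb
    _ = (∫⁻ y in ball x r, h y) + b * volume (ball x r) := by
      rw [lintegral_add_left hh, setLIntegral_const]
    _ ≤ _ := by
      rw [add_mul]
      gcongr
      exact setLIntegral_ball_le_hlMaximal h x hr

theorem hlMaximal_weak_type (hn : 1 ≤ n) (g : Eucl n → ℝ≥0∞) {l : ℝ≥0∞} (hl0 : l ≠ 0)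
    (hl : l ≠ ⊤) :
    l * volume {x | l < hlMaximal g x} ≤ 5 ^ n * ∫⁻ y, g y := by
  by_cases hI : ∫⁻ y, g y = ⊤
  · rw [hI, ENNReal.mul_top (by positivity)]
    exact le_top
  have hex : ∀ x ∈ {x | l < hlMaximal g x}, ∃ r : ℝ, 0 < r ∧
      l * volume (ball x r) < ∫⁻ y in ball x r, g y := by
    intro x hx
    replace hx : l < ⨆ (r : ℝ) (_ : 0 < r), (∫⁻ y in ball x r, g y) / volume (ball x r) := hx
    obtain ⟨r, hr⟩ := lt_iSup_iff.1 hx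
    obtain ⟨h0, hr⟩ := lt_iSup_iff.1 hr
    exact ⟨r, h0, (ENNReal.lt_div_iff_mul_lt (Or.inl (volume_ball_ne_zero _ h0))
      (Or.inl (volume_ball_ne_top _ _))).1 hr⟩
  choose! r hr0 hr using hex
  set A := {x | l < hlMaximal g x} with hA
  set c := volume (ball (0 : Eucl n) 1) with hc
  have hc0 : c ≠ 0 := volume_ball_ne_zero _ one_pos
  have hct : c ≠ ⊤ := volume_ball_ne_top _ _
  have hR : ∀ x ∈ A, r x ≤ max 1 ((∫⁻ y, g y) / (l * c)).toReal := by
    intro x hx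
    rcases le_total (r x) 1 with h1 | h1
    · exact h1.trans (le_max_left _ _)
    refine le_trans ?_ (le_max_right _ _)
    have h2 : ENNReal.ofReal (r x) ≤ (∫⁻ y, g y) / (l * c) := by
      rw [ENNReal.le_div_iff_mul_le (Or.inl (mul_ne_zero hl0 hc0))
        (Or.inl (ENNReal.mul_ne_top hl hct))]
      calc ENNReal.ofReal (r x) * (l * c) ≤ ENNReal.ofReal (r x ^ n) * (l * c) := by
            gcongr
            exact le_self_pow₀ h1 (by omega)
        _ = l * volume (ball x (r x)) := by
            rw [volume_ball_eucl x (hr0 x hx)]; ring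
        _ ≤ ∫⁻ y in ball x (r x), g y := (hr x hx).le
        _ ≤ ∫⁻ y, g y := setLIntegral_le_lintegral _ _
    exact (ENNReal.ofReal_le_iff_le_toReal
      (ENNReal.div_ne_top hI (mul_ne_zero hl0 hc0))).1 h2
  obtain ⟨u, huA, hdisj, hcov⟩ :=
    Vitali.exists_disjoint_subfamily_covering_enlargement_closedBall A id r _ hR 5 (by norm_num)
  have hu : u.Countable := by
    refine hdisj.countable_of_nonempty_interior fun x hx => ⟨x, ?_⟩
    exact ball_subset_interior_closedBall (mem_ball_self (hr0 x (huA hx)))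
  have hsub : A ⊆ ⋃ x ∈ u, closedBall x (5 * r x) := by
    intro x hx
    obtain ⟨b, hb, hxb⟩ := hcov x hx
    exact Set.mem_biUnion hb (hxb (mem_closedBall_self (hr0 x hx).le))
  calc l * volume A ≤ l * ∑' x : u, volume (closedBall (x : Eucl n) (5 * r x)) := by
        gcongr
        exact (measure_mono hsub).trans (measure_biUnion_le _ hu _)
    _ = ∑' x : u, l * volume (closedBall (x : Eucl n) (5 * r x)) := ENNReal.tsum_mul_left.symm
    _ ≤ ∑' x : u, 5 ^ n * ∫⁻ y in ball (x : Eucl n) (r x), g y := by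
        refine ENNReal.tsum_le_tsum fun x => ?_
        have h0 := hr0 x (huA x.2)
        rw [Measure.addHaar_closedBall _ _ (by positivity), finrank_euclideanSpace_fin, mul_pow,
          ENNReal.ofReal_mul (by positivity), mul_assoc, ← volume_ball_eucl (x : Eucl n) h0,
          mul_left_comm]
        have h5 : ENNReal.ofReal ((5 : ℝ) ^ n) = 5 ^ n := by
          rw [ENNReal.ofReal_pow (by norm_num)]; norm_num
        rw [h5]
        gcongr
        exact (hr x (huA x.2)).le
    _ = 5 ^ n * ∫⁻ y in ⋃ x ∈ u, ball x (r x), g y := by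
        have hdisj' : u.PairwiseDisjoint fun x => ball x (r x) :=
          hdisj.mono fun x => ball_subset_closedBall
        rw [ENNReal.tsum_mul_left, lintegral_biUnion hu (fun _ _ => measurableSet_ball) hdisj']
    _ ≤ 5 ^ n * ∫⁻ y, g y := by
        gcongr
        exact Measure.restrict_le_self

theorem measurableSet_ofReal_lt {X : Type*} [MeasurableSpace X] {h : X → ℝ≥0∞}
    (hh : Measurable h) : MeasurableSet {z : X × ℝ | 0 < z.2 ∧ ENNReal.ofReal z.2 < h z.1} :=
  (measurableSet_lt measurable_const measurable_snd).inter
    (measurableSet_lt (ENNReal.measurable_ofReal.comp measurable_snd) (hh.comp measurable_fst))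

theorem exists_lintegral_hlMaximal_rpow_le (hn : 1 ≤ n) {q : ℝ} (hq : 1 < q) :
    ∃ K : ℝ≥0∞, K ≠ ⊤ ∧ ∀ g : Eucl n → ℝ≥0∞, Measurable g →
      ∫⁻ x, hlMaximal g x ^ q ≤ K * ∫⁻ x, g x ^ q := by
  have hq0 : 0 < q := by linarith
  have hq1 : 0 < q - 1 := by linarith
  refine ⟨ENNReal.ofReal q * (2 * 5 ^ n * (2 ^ (q - 1) / ENNReal.ofReal (q - 1))), ?_, ?_⟩
  · refine ENNReal.mul_ne_top ofReal_ne_top (ENNReal.mul_ne_top (by finiteness) ?_)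
    exact ENNReal.div_ne_top (by finiteness) (by simpa using hq)
  intro g hg
  have hw (a : ℝ) : Measurable fun τ : ℝ => ENNReal.ofReal (τ ^ a) := by fun_prop
  have hM := lintegral_mul_setLIntegral_swap volume volume (g := fun _ : Eucl n => 1)
    measurable_const (hw (q - 1)) (measurableSet_ofReal_lt (measurable_hlMaximal g))
  have hG := lintegral_mul_setLIntegral_swap volume volume hg (hw (q - 1 - 1))
    (measurableSet_ofReal_lt (hg.const_mul 2))
  simp only [Set.mem_ofPred_eq, lintegral_ofReal_lt_rpow hq0, one_mul] at hM
  simp only [Set.mem_ofPred_eq, lintegral_ofReal_lt_rpow hq1] at hG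
  have hcomp : ∫⁻ τ : ℝ, ENNReal.ofReal (τ ^ (q - 1)) *
        ∫⁻ _ in {x | 0 < τ ∧ ENNReal.ofReal τ < hlMaximal g x}, 1 ≤
      ∫⁻ τ : ℝ, 2 * 5 ^ n * (ENNReal.ofReal (τ ^ (q - 1 - 1)) *
        ∫⁻ x in {x | 0 < τ ∧ ENNReal.ofReal τ < 2 * g x}, g x) := by
    refine lintegral_mono fun τ => ?_
    simp only
    rcases le_or_gt τ 0 with h0 | h0
    · simp [not_lt.2 h0]
    simp only [h0, true_and, setLIntegral_one]
    set B := {x | ENNReal.ofReal τ < 2 * g x} with hB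
    have hBm : MeasurableSet B := measurableSet_lt measurable_const (hg.const_mul 2)
    have hhalf : ENNReal.ofReal τ = ENNReal.ofReal (τ / 2) + ENNReal.ofReal (τ / 2) := by
      rw [← ENNReal.ofReal_add (by positivity) (by positivity), add_halves]
    have hsub : {x | ENNReal.ofReal τ < hlMaximal g x} ⊆
        {x | ENNReal.ofReal (τ / 2) < hlMaximal (B.indicator g) x} := by
      intro x hx
      have hle := hlMaximal_le_add (g := g) (hg.indicator hBm) (b := ENNReal.ofReal (τ / 2))
        (fun y => ?_) x
      · have hx' := lt_of_lt_of_le hx hle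
        rw [hhalf] at hx'
        exact lt_of_add_lt_add_right hx'
      · by_cases hy : y ∈ B
        · simp [hy]
        · simp only [hy, not_false_eq_true, Set.indicator_of_notMem, zero_add]
          simp only [hB, Set.mem_ofPred_eq, not_lt, hhalf, ← two_mul] at hy
          exact (ENNReal.mul_le_mul_iff_right two_ne_zero (by simp)).1 hy
    have hweak := hlMaximal_weak_type hn (B.indicator g) (l := ENNReal.ofReal (τ / 2))
      (by simpa using h0) ofReal_ne_top
    rw [lintegral_indicator hBm] at hweak
    calc ENNReal.ofReal (τ ^ (q - 1)) * volume {x | ENNReal.ofReal τ < hlMaximal g x}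
        ≤ ENNReal.ofReal (τ ^ (q - 1)) *
          volume {x | ENNReal.ofReal (τ / 2) < hlMaximal (B.indicator g) x} := by
          gcongr
      _ = 2 * ENNReal.ofReal (τ ^ (q - 1 - 1)) * (ENNReal.ofReal (τ / 2) *
          volume {x | ENNReal.ofReal (τ / 2) < hlMaximal (B.indicator g) x}) := by
          have : ENNReal.ofReal (τ ^ (q - 1)) =
              2 * ENNReal.ofReal (τ ^ (q - 1 - 1)) * ENNReal.ofReal (τ / 2) := by
            rw [Real.rpow_sub_one h0.ne' (q - 1), ← ENNReal.ofReal_ofNat 2,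
              ← ENNReal.ofReal_mul (by norm_num), ← ENNReal.ofReal_mul (by positivity)]
            congr 1
            field_simp
          rw [this, mul_assoc]
      _ ≤ 2 * ENNReal.ofReal (τ ^ (q - 1 - 1)) * (5 ^ n * ∫⁻ x in B, g x) := by gcongr
      _ = _ := by ring
  have hpt (x : Eucl n) : g x * ((2 * g x) ^ (q - 1) / ENNReal.ofReal (q - 1)) =
      2 ^ (q - 1) / ENNReal.ofReal (q - 1) * g x ^ q := by
    have : g x ^ q = g x * g x ^ (q - 1) := by
      conv_rhs => rw [← ENNReal.rpow_one (g x), ← ENNReal.rpow_mul, one_mul]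
      rw [← ENNReal.rpow_add_of_nonneg _ _ zero_le_one hq1.le, add_sub_cancel]
    rw [this, ENNReal.mul_rpow_of_nonneg _ _ hq1.le, ENNReal.div_eq_inv_mul,
      ENNReal.div_eq_inv_mul]
    ring
  calc ∫⁻ x, hlMaximal g x ^ q
      = ENNReal.ofReal q * ∫⁻ x, hlMaximal g x ^ q / ENNReal.ofReal q := by
        rw [← lintegral_const_mul' _ _ ofReal_ne_top]
        refine lintegral_congr fun x => ?_
        rw [ENNReal.mul_div_cancel (by simpa using hq0) ofReal_ne_top]
    _ ≤ ENNReal.ofReal q * (2 * 5 ^ n * ∫⁻ x, g x *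
          ((2 * g x) ^ (q - 1) / ENNReal.ofReal (q - 1))) := by
        rw [lintegral_const_mul' _ _ (by finiteness)] at hcomp
        rw [hM, hG]
        exact mul_le_mul' le_rfl hcomp
    _ = _ := by
        simp_rw [hpt]
        rw [lintegral_const_mul _ (hg.pow_const q)]
        ring

end Maximal

theorem ENNReal.le_mul_rpow_of_forall_le_add {a b : ℝ} (ha : 0 < a) (hb : 0 < b)
    {I K M N : ℝ≥0∞} (hK : K ≠ ⊤) (hN : N ≠ ⊤) (hNM : N = 0 → M = 0)
    (h : ∀ δ : ℝ, 0 < δ →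
      I ≤ K * (M * ENNReal.ofReal (δ ^ a) + N * ENNReal.ofReal (δ ^ (-b)))) :
    I ≤ 2 * K * (M ^ (b / (a + b)) * N ^ (a / (a + b))) := by
  have hab : 0 < a + b := by positivity
  by_cases hM0 : M = 0
  · have hlim : Filter.Tendsto (fun δ : ℝ => K * (N * ENNReal.ofReal (δ ^ (-b))))
        Filter.atTop (nhds 0) := by
      have h1 := ENNReal.tendsto_ofReal (tendsto_rpow_neg_atTop hb)
      have h2 := ENNReal.Tendsto.const_mul (a := K)
        (ENNReal.Tendsto.const_mul (a := N) h1 (Or.inr hN)) (Or.inr hK)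
      simpa using h2
    have hI : I ≤ 0 := by
      refine ge_of_tendsto hlim ?_
      filter_upwards [Filter.eventually_gt_atTop 0] with δ hδ
      simpa [hM0] using h δ hδ
    exact hI.trans zero_le
  have hN0 : N ≠ 0 := fun h => hM0 (hNM h)
  by_cases hK0 : K = 0
  · simpa [hK0] using h 1 one_pos
  by_cases hM : M = ⊤
  · rw [hM, ENNReal.top_rpow_of_pos (by positivity), ENNReal.top_mul, ENNReal.mul_top]
    · exact le_top
    · exact mul_ne_zero two_ne_zero hK0
    · exact (ENNReal.rpow_pos (pos_iff_ne_zero.2 hN0) hN).ne'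
  lift M to NNReal using hM
  lift N to NNReal using hN
  have hM' : 0 < (M : ℝ) := by exact_mod_cast pos_iff_ne_zero.2 (by simpa using hM0)
  have hN' : 0 < (N : ℝ) := by exact_mod_cast pos_iff_ne_zero.2 (by simpa using hN0)
  have hδ : 0 < ((N : ℝ) / M) ^ (1 / (a + b)) := by positivity
  have hMa : (M : ℝ) * (((N : ℝ) / M) ^ (1 / (a + b))) ^ a =
      M ^ (b / (a + b)) * N ^ (a / (a + b)) := by
    rw [← Real.rpow_mul (by positivity), Real.div_rpow hN'.le hM'.le,
      show 1 / (a + b) * a = a / (a + b) by ring,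
      show b / (a + b) = 1 - a / (a + b) by field_simp; ring, Real.rpow_sub hM', Real.rpow_one]
    ring
  have hNb : (N : ℝ) * (((N : ℝ) / M) ^ (1 / (a + b))) ^ (-b) =
      M ^ (b / (a + b)) * N ^ (a / (a + b)) := by
    rw [← Real.rpow_mul (by positivity), Real.div_rpow hN'.le hM'.le,
      show 1 / (a + b) * -b = -(b / (a + b)) by ring,
      show a / (a + b) = 1 - b / (a + b) by field_simp; ring, Real.rpow_sub hN', Real.rpow_one,
      Real.rpow_neg hN'.le, Real.rpow_neg hM'.le]
    field_simp
  refine (h _ hδ).trans (le_of_eq ?_)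
  rw [← ENNReal.ofReal_coe_nnreal (p := M), ← ENNReal.ofReal_coe_nnreal (p := N),
    ← ENNReal.ofReal_mul hM'.le, ← ENNReal.ofReal_mul hN'.le, hMa, hNb,
    ENNReal.ofReal_rpow_of_pos hM', ENNReal.ofReal_rpow_of_pos hN',
    ← ENNReal.ofReal_mul (by positivity)]
  ring

section Morrey

variable {n : ℕ}

theorem setLIntegral_rpow_le_morreyNorm {p q : ℝ} (hq : 0 < q) (f : Eucl n → ℝ) (z : Eucl n)
    {r : ℝ} (hr : 0 < r) :
    ∫⁻ y in ball z r, ‖f y‖ₑ ^ q ≤ volume (ball z r) ^ (1 - q / p) * morreyNorm n p q f ^ q := by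
  have hv0 := volume_ball_ne_zero z hr
  have hvt := volume_ball_ne_top z r
  have h : volume (ball z r) ^ (1 / p - 1 / q) *
      (∫⁻ y in ball z r, ENNReal.ofReal (|f y| ^ q)) ^ (1 / q) ≤ morreyNorm n p q f :=
    le_iSup_of_le z (le_iSup₂_of_le r hr le_rfl)
  have he (y : Eucl n) : ENNReal.ofReal (|f y| ^ q) = ‖f y‖ₑ ^ q := by
    rw [← ENNReal.ofReal_rpow_of_nonneg (abs_nonneg _) hq.le, Real.enorm_eq_ofReal_abs]
  simp_rw [he] at h
  calc ∫⁻ y in ball z r, ‖f y‖ₑ ^ q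
      = volume (ball z r) ^ (1 - q / p) * (volume (ball z r) ^ (1 / p - 1 / q) *
        (∫⁻ y in ball z r, ‖f y‖ₑ ^ q) ^ (1 / q)) ^ q := by
        rw [ENNReal.mul_rpow_of_nonneg _ _ hq.le, ← ENNReal.rpow_mul, ← ENNReal.rpow_mul,
          ← mul_assoc, ← ENNReal.rpow_add _ _ hv0 hvt, one_div_mul_cancel hq.ne',
          show 1 - q / p + (1 / p - 1 / q) * q = 0 by field_simp; ring]
        simp
    _ ≤ _ := by gcongr

theorem setLIntegral_ball_le_of_morrey {p q : ℝ} (hq : 1 < q) {g : Eucl n → ℝ≥0∞}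
    (hg : Measurable g) {N : ℝ≥0∞} {z : Eucl n} {r : ℝ} (hr : 0 < r)
    (H : ∫⁻ y in ball z r, g y ^ q ≤ volume (ball z r) ^ (1 - q / p) * N ^ q) :
    ∫⁻ y in ball z r, g y ≤ volume (ball z r) ^ (1 - 1 / p) * N := by
  have hv0 := volume_ball_ne_zero z hr
  have hvt := volume_ball_ne_top z r
  have hq0 : 0 < q := by linarith
  have hc := Real.HolderConjugate.conjExponent hq
  have hh := ENNReal.lintegral_mul_le_Lp_mul_Lq (volume.restrict (ball z r)) hc
    hg.aemeasurable (aemeasurable_const (b := (1 : ℝ≥0∞)))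
  simp only [Pi.mul_apply, mul_one, ENNReal.one_rpow, setLIntegral_one] at hh
  have hexp : 1 / q.conjExponent = 1 - 1 / q := by
    have := hc.inv_add_inv_eq_one
    rw [one_div, one_div]; linarith
  rw [hexp] at hh
  calc ∫⁻ y in ball z r, g y
      ≤ (volume (ball z r) ^ (1 - q / p) * N ^ q) ^ (1 / q) *
          volume (ball z r) ^ (1 - 1 / q) := hh.trans (by gcongr)
    _ = volume (ball z r) ^ (1 - 1 / p) * N := by
      rw [ENNReal.mul_rpow_of_nonneg _ _ (by positivity), ← ENNReal.rpow_mul, ← ENNReal.rpow_mul,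
        mul_right_comm, ← ENNReal.rpow_add _ _ hv0 hvt, mul_one_div_cancel hq0.ne',
        ENNReal.rpow_one]
      congr 2
      field_simp
      ring

theorem hlMaximal_le_local_add {p : ℝ} (hp : 0 < p) {g : Eucl n → ℝ≥0∞} {N : ℝ≥0∞}
    (H : ∀ (z : Eucl n) (r : ℝ), 0 < r →
      ∫⁻ y in ball z r, g y ≤ volume (ball z r) ^ (1 - 1 / p) * N)
    {x z : Eucl n} {r : ℝ} (hr : 0 < r) (hx : x ∈ ball z r) :
    hlMaximal g x ≤ hlMaximal ((ball z (2 * r)).indicator g) x +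
      volume (ball z r) ^ (-(1 / p)) * N := by
  refine iSup₂_le fun ρ hρ => ?_
  rcases le_or_gt ρ r with h | h
  · refine le_add_right (le_iSup₂_of_le ρ hρ ?_)
    refine ENNReal.div_le_div_right (setLIntegral_mono' measurableSet_ball fun y hy => ?_) _
    rw [Set.indicator_of_mem]
    exact ball_subset_ball' (by rw [mem_ball] at hx; linarith) hy
  · refine le_add_left ?_
    rw [ENNReal.div_le_iff (volume_ball_ne_zero _ hρ) (volume_ball_ne_top _ _)]
    refine (H x ρ hρ).trans ?_
    rw [sub_eq_neg_add, ENNReal.rpow_add _ _ (volume_ball_ne_zero _ hρ) (volume_ball_ne_top _ _),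
      ENNReal.rpow_one, mul_right_comm]
    gcongr ?_ * _ * _
    rw [ENNReal.rpow_neg, ENNReal.rpow_neg, ENNReal.inv_le_inv]
    refine ENNReal.rpow_le_rpow ?_ (by positivity)
    rw [volume_ball_eucl z hr, volume_ball_eucl x hρ]
    gcongr

theorem exists_setLIntegral_hlMaximal_rpow_le (hn : 1 ≤ n) {p q : ℝ} (hq : 1 < q) (hqp : q ≤ p) :
    ∃ K : ℝ≥0∞, K ≠ ⊤ ∧ ∀ (g : Eucl n → ℝ≥0∞) (N : ℝ≥0∞), Measurable g →
      (∀ (z : Eucl n) (r : ℝ), 0 < r →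
        ∫⁻ y in ball z r, g y ^ q ≤ volume (ball z r) ^ (1 - q / p) * N ^ q) →
      ∀ (z : Eucl n) (r : ℝ), 0 < r → ∫⁻ x in ball z r, hlMaximal g x ^ q ≤
        K * (volume (ball z r) ^ (1 - q / p) * N ^ q) := by
  have hq0 : 0 < q := by linarith
  have hp0 : 0 < p := by linarith
  have he : 0 ≤ 1 - q / p := sub_nonneg.2 ((div_le_one hp0).2 hqp)
  obtain ⟨K, hK, hmax⟩ := exists_lintegral_hlMaximal_rpow_le hn hq
  refine ⟨2 ^ (q - 1) * (K * (2 ^ n) ^ (1 - q / p) + 1), ?_, ?_⟩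
  · have : (2 : ℝ≥0∞) ^ (q - 1) ≠ ⊤ := ENNReal.rpow_ne_top_of_nonneg (by linarith) (by simp)
    have : ((2 : ℝ≥0∞) ^ n) ^ (1 - q / p) ≠ ⊤ := ENNReal.rpow_ne_top_of_nonneg he (by finiteness)
    finiteness
  intro g N hg H z r hr
  have hv0 := volume_ball_ne_zero z hr
  have hvt := volume_ball_ne_top z r
  have hloc : ∫⁻ x in ball z r, hlMaximal ((ball z (2 * r)).indicator g) x ^ q ≤
      K * (2 ^ n) ^ (1 - q / p) * (volume (ball z r) ^ (1 - q / p) * N ^ q) := by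
    calc ∫⁻ x in ball z r, hlMaximal ((ball z (2 * r)).indicator g) x ^ q
        ≤ ∫⁻ x, hlMaximal ((ball z (2 * r)).indicator g) x ^ q := setLIntegral_le_lintegral _ _
      _ ≤ K * ∫⁻ x, (ball z (2 * r)).indicator g x ^ q :=
        hmax _ (hg.indicator measurableSet_ball)
      _ = K * ∫⁻ x in ball z (2 * r), g x ^ q := by
        rw [← lintegral_indicator measurableSet_ball]
        congr 2 with x
        by_cases hx : x ∈ ball z (2 * r) <;>
          simp only [hx, Set.indicator_of_mem, Set.indicator_of_notMem, not_false_eq_true,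
            ENNReal.zero_rpow_of_pos hq0]
      _ ≤ K * (volume (ball z (2 * r)) ^ (1 - q / p) * N ^ q) := by
        gcongr
        exact H z _ (by positivity)
      _ = _ := by
        rw [volume_ball_eucl z (by positivity : 0 < 2 * r), mul_pow,
          ENNReal.ofReal_mul (by positivity), mul_assoc (ENNReal.ofReal _), ← volume_ball_eucl z hr,
          ENNReal.mul_rpow_of_nonneg _ _ he, ENNReal.ofReal_pow (by norm_num),
          ENNReal.ofReal_ofNat]
        ring
  have hfar : ∫⁻ _ in ball z r, (volume (ball z r) ^ (-(1 / p)) * N) ^ q =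
      volume (ball z r) ^ (1 - q / p) * N ^ q := by
    rw [setLIntegral_const, ENNReal.mul_rpow_of_nonneg _ _ hq0.le, ← ENNReal.rpow_mul,
      mul_right_comm]
    nth_rw 2 [← ENNReal.rpow_one (volume (ball z r))]
    rw [← ENNReal.rpow_add _ _ hv0 hvt]
    congr 2
    ring
  calc ∫⁻ x in ball z r, hlMaximal g x ^ q
      ≤ ∫⁻ x in ball z r, 2 ^ (q - 1) * (hlMaximal ((ball z (2 * r)).indicator g) x ^ q +
          (volume (ball z r) ^ (-(1 / p)) * N) ^ q) := by
        refine setLIntegral_mono' measurableSet_ball fun x hx => ?_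
        refine le_trans ?_ (ENNReal.rpow_add_le_mul_rpow_add_rpow _ _ hq.le)
        gcongr
        exact hlMaximal_le_local_add hp0
          (fun z r hr => setLIntegral_ball_le_of_morrey hq hg hr (H z r hr)) hr hx
    _ = 2 ^ (q - 1) * ((∫⁻ x in ball z r, hlMaximal ((ball z (2 * r)).indicator g) x ^ q) +
          volume (ball z r) ^ (1 - q / p) * N ^ q) := by
        rw [lintegral_const_mul' _ _ (ENNReal.rpow_ne_top_of_nonneg (by linarith) (by simp)),
          lintegral_add_right _ measurable_const, hfar]
    _ ≤ 2 ^ (q - 1) * (K * (2 ^ n) ^ (1 - q / p) * (volume (ball z r) ^ (1 - q / p) * N ^ q) +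
          volume (ball z r) ^ (1 - q / p) * N ^ q) := by gcongr
    _ = _ := by ring

end Morrey

section Hedberg

variable {n : ℕ}

theorem lintegral_riesz_le {α : ℝ} (hαn : α < n) {g : Eucl n → ℝ≥0∞} (hg : Measurable g)
    (x : Eucl n) :
    ∫⁻ y, g y * ENNReal.ofReal (dist x y ^ (α - n)) ≤ ENNReal.ofReal (n - α) *
      ∫⁻ ρ : ℝ, ENNReal.ofReal (ρ ^ (-(n - α) - 1)) * ∫⁻ y in ball x ρ, g y := by
  have hb : 0 < (n : ℝ) - α := sub_pos.2 hαn
  have hS : MeasurableSet {z : Eucl n × ℝ | dist x z.1 < z.2} :=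
    measurableSet_lt (by fun_prop) measurable_snd
  have hswap := lintegral_mul_setLIntegral_swap volume volume hg
    (w := fun ρ : ℝ => ENNReal.ofReal (ρ ^ (-(n - α) - 1))) (by fun_prop) hS
  have hball (ρ : ℝ) : {y | dist x y < ρ} = ball x ρ := by
    ext y; simp [dist_comm]
  simp only [Set.mem_ofPred_eq, hball] at hswap
  rw [← hswap, ← lintegral_const_mul' _ _ ofReal_ne_top]
  refine lintegral_mono fun y => ?_
  rw [mul_left_comm]
  gcongr
  rcases (dist_nonneg (x := x) (y := y)).eq_or_lt with h0 | h0
  · rw [← h0, Real.zero_rpow (by linarith)]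
    simp
  · change _ ≤ ENNReal.ofReal (n - α) * ∫⁻ ρ in Set.Ioi (dist x y), _
    rw [lintegral_Ioi_rpow hb h0, ← ENNReal.ofReal_mul hb.le, mul_div_cancel₀ _ hb.ne', neg_sub]

theorem exists_lintegral_riesz_le_hlMaximal {α p : ℝ} (hα : 0 < α) (hαn : α < n) (hp : 1 < p)
    (hαp : α < n / p) :
    ∃ K : ℝ≥0∞, K ≠ ⊤ ∧ ∀ (g : Eucl n → ℝ≥0∞) (N : ℝ≥0∞), Measurable g → N ≠ ⊤ →
      (∀ (z : Eucl n) (r : ℝ), 0 < r →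
        ∫⁻ y in ball z r, g y ≤ volume (ball z r) ^ (1 - 1 / p) * N) →
      ∀ x, ∫⁻ y, g y * ENNReal.ofReal (dist x y ^ (α - n)) ≤
        K * (hlMaximal g x ^ (1 - α * p / n) * N ^ (α * p / n)) := by
  have hn0 : (0 : ℝ) < n := hα.trans hαn
  have hp0 : 0 < p := by linarith
  have hb : 0 < n / p - α := sub_pos.2 hαp
  have he : 0 ≤ 1 - 1 / p := sub_nonneg.2 ((div_le_one hp0).2 hp.le)
  set c := volume (ball (0 : Eucl n) 1) with hc
  have hct : c ≠ ⊤ := volume_ball_ne_top _ _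
  have hcet : c ^ (1 - 1 / p) ≠ ⊤ := ENNReal.rpow_ne_top_of_nonneg he hct
  set K := ENNReal.ofReal (n - α) *
    (c * ENNReal.ofReal (1 / α) + c ^ (1 - 1 / p) * ENNReal.ofReal (1 / (n / p - α))) with hK
  have hKt : K ≠ ⊤ := by finiteness
  refine ⟨2 * K, by finiteness, fun g N hg hN H x => ?_⟩
  have h1 : (n / p - α) / (α + (n / p - α)) = 1 - α * p / n := by
    rw [add_sub_cancel]; field_simp
  have h2 : α / (α + (n / p - α)) = α * p / n := by
    rw [add_sub_cancel]; field_simp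
  rw [← h1, ← h2]
  refine ENNReal.le_mul_rpow_of_forall_le_add hα hb hKt hN ?_ fun δ hδ => ?_
  · rintro rfl
    rw [hlMaximal]
    simp only [ENNReal.iSup_eq_zero]
    intro r hr
    have := H x r hr
    rw [mul_zero, nonpos_iff_eq_zero] at this
    simp [this]
  set M := hlMaximal g x
  have hpt (ρ : ℝ) : ENNReal.ofReal (ρ ^ (-(n - α) - 1)) * ∫⁻ y in ball x ρ, g y ≤
      (Set.Ioc 0 δ).indicator (fun ρ => c * M * ENNReal.ofReal (ρ ^ (α - 1))) ρ +
      (Set.Ioi δ).indicator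
        (fun ρ => c ^ (1 - 1 / p) * N * ENNReal.ofReal (ρ ^ (-(n / p - α) - 1))) ρ := by
    rcases le_or_gt ρ 0 with h0 | h0
    · simp [ball_eq_empty.2 h0]
    rcases le_or_gt ρ δ with h | h
    · refine le_add_right ?_
      rw [Set.indicator_of_mem (show ρ ∈ Set.Ioc 0 δ from ⟨h0, h⟩)]
      refine (mul_le_mul' le_rfl (setLIntegral_ball_le_hlMaximal g x h0)).trans (le_of_eq ?_)
      have : ENNReal.ofReal (ρ ^ (α - 1)) =
          ENNReal.ofReal (ρ ^ (-(n - α) - 1)) * ENNReal.ofReal (ρ ^ n) := by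
        rw [← ENNReal.ofReal_mul (by positivity), ← Real.rpow_natCast, ← Real.rpow_add h0]
        ring_nf
      rw [volume_ball_eucl x h0, this]
      ring
    · refine le_add_left ?_
      rw [Set.indicator_of_mem (show ρ ∈ Set.Ioi δ from h)]
      refine (mul_le_mul' le_rfl (H x ρ h0)).trans (le_of_eq ?_)
      have : ENNReal.ofReal (ρ ^ (-(n / p - α) - 1)) =
          ENNReal.ofReal (ρ ^ (-(n - α) - 1)) * ENNReal.ofReal (ρ ^ n) ^ (1 - 1 / p) := by
        rw [ENNReal.ofReal_rpow_of_nonneg (by positivity) he,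
          ← ENNReal.ofReal_mul (by positivity), ← Real.rpow_natCast, ← Real.rpow_mul h0.le,
          ← Real.rpow_add h0]
        ring_nf
      rw [volume_ball_eucl x h0, this, ENNReal.mul_rpow_of_nonneg _ _ he]
      ring
  refine (lintegral_riesz_le hαn hg x).trans ?_
  calc ENNReal.ofReal (n - α) *
        ∫⁻ ρ : ℝ, ENNReal.ofReal (ρ ^ (-(n - α) - 1)) * ∫⁻ y in ball x ρ, g y
      ≤ ENNReal.ofReal (n - α) * (c * M * ENNReal.ofReal (δ ^ α / α) +
          c ^ (1 - 1 / p) * N * ENNReal.ofReal (δ ^ (-(n / p - α)) / (n / p - α))) := by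
        gcongr
        refine (lintegral_mono hpt).trans (le_of_eq ?_)
        rw [lintegral_add_left ((by fun_prop : Measurable _).indicator measurableSet_Ioc),
          lintegral_indicator measurableSet_Ioc, lintegral_indicator measurableSet_Ioi,
          lintegral_const_mul _ (by fun_prop), lintegral_const_mul _ (by fun_prop),
          lintegral_Ioc_rpow hα hδ.le, lintegral_Ioi_rpow hb hδ]
    _ = ENNReal.ofReal (n - α) * (c * ENNReal.ofReal (1 / α) * (M * ENNReal.ofReal (δ ^ α)) +
          c ^ (1 - 1 / p) * ENNReal.ofReal (1 / (n / p - α)) *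
            (N * ENNReal.ofReal (δ ^ (-(n / p - α))))) := by
        rw [div_eq_mul_one_div (δ ^ α), div_eq_mul_one_div (δ ^ (-(n / p - α))),
          ENNReal.ofReal_mul (by positivity), ENNReal.ofReal_mul (by positivity)]
        ring
    _ ≤ K * (M * ENNReal.ofReal (δ ^ α) + N * ENNReal.ofReal (δ ^ (-(n / p - α)))) := by
        rw [hK, mul_assoc (ENNReal.ofReal (n - α))]
        gcongr
        rw [mul_add]
        gcongr
        · exact le_self_add
        · exact le_add_self

end Hedberg

section Adams

variable {n : ℕ}

theorem ae_hlMaximal_lt_top {q : ℝ} (hq : 0 < q) {g : Eucl n → ℝ≥0∞}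
    (h : ∀ r : ℝ, 0 < r → ∫⁻ x in ball (0 : Eucl n) r, hlMaximal g x ^ q < ⊤) :
    ∀ᵐ x, hlMaximal g x < ⊤ := by
  have hU : ⋃ m : ℕ, ball (0 : Eucl n) ((m : ℝ) + 1) = Set.univ := by
    refine Set.eq_univ_of_forall fun x => Set.mem_iUnion.2 ?_
    obtain ⟨m, hm⟩ := exists_nat_gt (dist x 0)
    exact ⟨m, by rw [mem_ball]; linarith⟩
  rw [← Measure.restrict_univ (μ := volume), ← hU, ae_restrict_iUnion_iff]
  intro m
  filter_upwards [ae_lt_top ((measurable_hlMaximal g).pow_const q)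
    (h (m + 1) (by positivity)).ne] with x hx
  exact (ENNReal.rpow_lt_top_iff_of_pos hq).1 hx

theorem morreyNorm_le_of_enorm_le {p q s t θ : ℝ} (hp : 0 < p) (hs : 0 < s) (ht : 0 < t)
    (hθ1 : θ ≤ 1) (hθs : θ * s = p) (hθt : θ * t = q) {F : Eucl n → ℝ}
    {M : Eucl n → ℝ≥0∞} (hM : Measurable M) {K L N : ℝ≥0∞}
    (hF : ∀ x, ‖F x‖ₑ ≤ K * (M x ^ θ * N ^ (1 - θ)))
    (hMN : ∀ (z : Eucl n) (r : ℝ), 0 < r →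
      ∫⁻ x in ball z r, M x ^ q ≤ L * (volume (ball z r) ^ (1 - q / p) * N ^ q)) :
    morreyNorm n s t F ≤ K * L ^ (1 / t) * N := by
  refine iSup_le fun z => iSup₂_le fun r hr => ?_
  have hv0 := volume_ball_ne_zero z hr
  have hvt := volume_ball_ne_top z r
  have hθ : 0 < θ := by
    by_contra h
    nlinarith
  have hq : 0 < q := hθt ▸ mul_pos hθ ht
  have hN : (N ^ (1 - θ)) ^ t * N ^ q = N ^ t := by
    rw [← ENNReal.rpow_mul, ← ENNReal.rpow_add_of_nonneg _ _
      (mul_nonneg (sub_nonneg.2 hθ1) ht.le) hq.le]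
    congr 1
    linarith
  have hint : ∫⁻ y in ball z r, ENNReal.ofReal (|F y| ^ t) ≤
      K ^ t * (L * volume (ball z r) ^ (1 - q / p)) * N ^ t := by
    calc ∫⁻ y in ball z r, ENNReal.ofReal (|F y| ^ t)
        ≤ ∫⁻ y in ball z r, K ^ t * (N ^ (1 - θ)) ^ t * M y ^ q := by
          refine lintegral_mono fun y => ?_
          simp only
          rw [← ENNReal.ofReal_rpow_of_nonneg (abs_nonneg _) ht.le, ← Real.enorm_eq_ofReal_abs]
          refine (ENNReal.rpow_le_rpow (hF y) ht.le).trans (le_of_eq ?_)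
          rw [ENNReal.mul_rpow_of_nonneg _ _ ht.le, ENNReal.mul_rpow_of_nonneg _ _ ht.le,
            ← ENNReal.rpow_mul (M y), hθt]
          ring
      _ = K ^ t * (N ^ (1 - θ)) ^ t * ∫⁻ y in ball z r, M y ^ q :=
          lintegral_const_mul _ (hM.pow_const q)
      _ ≤ K ^ t * (N ^ (1 - θ)) ^ t * (L * (volume (ball z r) ^ (1 - q / p) * N ^ q)) := by
          gcongr
          exact hMN z r hr
      _ = K ^ t * (L * volume (ball z r) ^ (1 - q / p)) * ((N ^ (1 - θ)) ^ t * N ^ q) := by ring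
      _ = _ := by rw [hN]
  calc volume (ball z r) ^ (1 / s - 1 / t) *
        (∫⁻ y in ball z r, ENNReal.ofReal (|F y| ^ t)) ^ (1 / t)
      ≤ volume (ball z r) ^ (1 / s - 1 / t) *
        (K ^ t * (L * volume (ball z r) ^ (1 - q / p)) * N ^ t) ^ (1 / t) := by gcongr
    _ = volume (ball z r) ^ (1 / s - 1 / t) * volume (ball z r) ^ ((1 - q / p) * (1 / t)) *
        (K * L ^ (1 / t) * N) := by
        have ht' : 0 ≤ 1 / t := by positivity
        rw [ENNReal.mul_rpow_of_nonneg _ _ ht', ENNReal.mul_rpow_of_nonneg _ _ ht',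
          ENNReal.mul_rpow_of_nonneg _ _ ht', ← ENNReal.rpow_mul, ← ENNReal.rpow_mul,
          ← ENNReal.rpow_mul, mul_one_div_cancel ht.ne', ENNReal.rpow_one, ENNReal.rpow_one]
        ring
    _ = _ := by
        rw [← ENNReal.rpow_add _ _ hv0 hvt]
        have : 1 / s - 1 / t + (1 - q / p) * (1 / t) = 0 := by
          rw [← hθs, ← hθt]
          field_simp
          ring
        rw [this, ENNReal.rpow_zero, one_mul]

end Adams

/-- Adams' theorem: for `f ∈ M^p_q` the integral defining `I_α f(x)`
converges absolutely for a.e. `x`, and `I_α` is bounded from `M^p_q` to `M^s_t`. -/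
theorem adams_fracInt_morrey
    (n : ℕ) (hn : 1 ≤ n) (α p q s t : ℝ)
    (hα : 0 < α) (hαn : α < n) (hq : 1 < q) (hqp : q ≤ p)
    (hs : 1 / s = 1 / p - α / n) (hs0 : 0 < 1 / s) (hst : p / q = s / t) :
    (∀ f : Eucl n → ℝ, MemMorrey n p q f →
      ∀ᵐ x ∂(volume : Measure (Eucl n)),
        Integrable (fun y => f y * dist x y ^ (α - (n : ℝ))) volume) ∧
    ∃ C : ℝ, 0 < C ∧ ∀ f : Eucl n → ℝ, MemMorrey n p q f →
      morreyNorm n s t (fracInt n α f) ≤ ENNReal.ofReal C * morreyNorm n p q f := by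
  have hn0 : (0 : ℝ) < n := hα.trans hαn
  have hq0 : 0 < q := by linarith
  have hp0 : 0 < p := by linarith
  have hs' : 0 < s := one_div_pos.1 hs0
  have ht : 0 < t := (div_pos_iff_of_pos_left hs').1 (hst ▸ div_pos hp0 hq0)
  have hαp : α < n / p := by
    rw [hs, sub_pos, div_lt_iff₀ hn0] at hs0
    calc α < 1 / p * n := hs0
      _ = n / p := by ring
  have hθs : (1 - α * p / n) * s = p := by
    have : 1 - α * p / n = p * (1 / s) := by rw [hs]; field_simp
    rw [this]; field_simp
  have hθt : (1 - α * p / n) * t = q := by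
    rw [div_eq_div_iff hq0.ne' ht.ne'] at hst
    refine mul_right_cancel₀ hs'.ne' ?_
    rw [mul_right_comm, hθs, hst, mul_comm]
  have hθ1 : 1 - α * p / n ≤ 1 := sub_le_self _ (by positivity)
  have hθ0 : 0 ≤ 1 - α * p / n := nonneg_of_mul_nonneg_left (hθs.ge.trans' hp0.le) hs'
  obtain ⟨K, hK, hhed⟩ := exists_lintegral_riesz_le_hlMaximal hα hαn (hq.trans_le hqp) hαp
  obtain ⟨L, hL, hmax⟩ := exists_setLIntegral_hlMaximal_rpow_le hn hq hqp
  have hg (f : Eucl n → ℝ) (hf : MemMorrey n p q f) : Measurable fun y => ‖f y‖ₑ := hf.1.enorm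
  have hmor (f : Eucl n → ℝ) (z : Eucl n) (r : ℝ) (hr : 0 < r) :=
    setLIntegral_rpow_le_morreyNorm (p := p) hq0 f z hr
  have hker (f : Eucl n → ℝ) (hf : MemMorrey n p q f) (x : Eucl n) :
      ∫⁻ y, ‖f y * dist x y ^ (α - (n : ℝ))‖ₑ ≤
        K * (hlMaximal (fun y => ‖f y‖ₑ) x ^ (1 - α * p / n) *
          morreyNorm n p q f ^ (α * p / n)) := by
    refine le_trans (le_of_eq (lintegral_congr fun y => ?_))
      (hhed _ _ (hg f hf) hf.2.ne (fun z r hr =>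
        setLIntegral_ball_le_of_morrey hq (hg f hf) hr (hmor f z r hr)) x)
    rw [enorm_mul, Real.enorm_of_nonneg (Real.rpow_nonneg dist_nonneg _)]
  have hmaxf (f : Eucl n → ℝ) (hf : MemMorrey n p q f) :=
    hmax _ _ (hg f hf) (hmor f)
  constructor
  · intro f hf
    have hfin : ∀ᵐ x, hlMaximal (fun y => ‖f y‖ₑ) x < ⊤ := by
      refine ae_hlMaximal_lt_top hq0 fun r hr => (hmaxf f hf 0 r hr).trans_lt ?_
      refine ENNReal.mul_lt_top hL.lt_top (ENNReal.mul_lt_top ?_ ?_)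
      · exact ENNReal.rpow_lt_top_of_nonneg (sub_nonneg.2 ((div_le_one hp0).2 hqp))
          (volume_ball_ne_top _ _)
      · exact ENNReal.rpow_lt_top_of_nonneg hq0.le hf.2.ne
    filter_upwards [hfin] with x hx
    refine ⟨(hf.1.mul (by fun_prop)).aestronglyMeasurable, (hker f hf x).trans_lt ?_⟩
    refine ENNReal.mul_lt_top hK.lt_top (ENNReal.mul_lt_top ?_ ?_)
    · exact ENNReal.rpow_lt_top_of_nonneg hθ0 hx.ne
    · exact ENNReal.rpow_lt_top_of_nonneg (by positivity) hf.2.ne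
  · have hC : K * L ^ (1 / t) ≠ ⊤ :=
      ENNReal.mul_ne_top hK (ENNReal.rpow_ne_top_of_nonneg (by positivity) hL)
    refine ⟨(K * L ^ (1 / t)).toReal + 1, by positivity, fun f hf => ?_⟩
    have hbound : morreyNorm n s t (fracInt n α f) ≤ K * L ^ (1 / t) * morreyNorm n p q f := by
      refine morreyNorm_le_of_enorm_le hp0 hs' ht hθ1 hθs hθt
        (measurable_hlMaximal fun y => ‖f y‖ₑ) (fun x => ?_) (hmaxf f hf)
      rw [_root_.sub_sub_cancel]
      exact (enorm_integral_le_lintegral_enorm _).trans (hker f hf x)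
    refine hbound.trans ?_
    gcongr
    rw [ENNReal.le_ofReal_iff_toReal_le hC (by positivity)]
    linarith
end
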